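/- Let M be a dominant feasible matching in a marriage instance with critical men C. Then there exists a level assignment that satisfies the dominant conditions for M and, in addition, assigns every man a level at most |C| + 1 (with every non-critical man at level at most 1). -/

import Mathlib

open Classical

universe u v

/-- A marriage instance with critical men: a finite bipartite graph with edge set `E ⊆ A × B`,
a set `C ⊆ A` of critical men, and strict preference orders of each vertex over its
neighbours (`prefA m w w'` : man `m` strictly prefers woman `w` to woman `w'`;
`prefB w m m'` : woman `w` strictly prefers man `m` to man `m'`). -/
structure CritInstance (A : Type u) (B : Type v) where
  E : Finset (A × B)
  C : Finset A
  prefA : A → B → B → Prop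
  prefB : B → A → A → Prop
  prefA_irrefl : ∀ m w, ¬ prefA m w w
  prefA_trans : ∀ m w₁ w₂ w₃, prefA m w₁ w₂ → prefA m w₂ w₃ → prefA m w₁ w₃
  prefA_total : ∀ m w₁ w₂, (m, w₁) ∈ E → (m, w₂) ∈ E → w₁ ≠ w₂ →
    prefA m w₁ w₂ ∨ prefA m w₂ w₁
  prefB_irrefl : ∀ w m, ¬ prefB w m m
  prefB_trans : ∀ w m₁ m₂ m₃, prefB w m₁ m₂ → prefB w m₂ m₃ → prefB w m₁ m₃
  prefB_total : ∀ w m₁ m₂, (m₁, w) ∈ E → (m₂, w) ∈ E → m₁ ≠ m₂ →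
    prefB w m₁ m₂ ∨ prefB w m₂ m₁

namespace CritInstance

variable {A : Type u} {B : Type v}

/-- `M` is a matching: a set of edges in which every vertex has at most one partner. -/
def IsMatching (I : CritInstance A B) (M : Finset (A × B)) : Prop :=
  M ⊆ I.E ∧ (∀ ⦃m w w'⦄, (m, w) ∈ M → (m, w') ∈ M → w = w') ∧
    (∀ ⦃m m' w⦄, (m, w) ∈ M → (m', w) ∈ M → m = m')

/-- Man `m` is matched in `M`. -/
def ManMatched (M : Finset (A × B)) (m : A) : Prop := ∃ w, (m, w) ∈ M

/-- Woman `w` is matched in `M`. -/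
def WomanMatched (M : Finset (A × B)) (w : B) : Prop := ∃ m, (m, w) ∈ M

/-- `M` is feasible: it is a matching and every critical man is matched. -/
def IsFeasible (I : CritInstance A B) (M : Finset (A × B)) : Prop :=
  IsMatching I M ∧ ∀ m ∈ I.C, ManMatched M m

/-- Man `m` prefers matching `M` to matching `N`: he is matched in `M` and either
unmatched in `N` or strictly prefers his `M`-partner to his `N`-partner. -/
def ManPrefers (I : CritInstance A B) (M N : Finset (A × B)) (m : A) : Prop :=
  ∃ w, (m, w) ∈ M ∧ (¬ ManMatched N m ∨ ∃ w', (m, w') ∈ N ∧ I.prefA m w w')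

/-- Woman `w` prefers matching `M` to matching `N`. -/
def WomanPrefers (I : CritInstance A B) (M N : Finset (A × B)) (w : B) : Prop :=
  ∃ m, (m, w) ∈ M ∧ (¬ WomanMatched N w ∨ ∃ m', (m', w) ∈ N ∧ I.prefB w m m')

/-- `phi I M N` is the number of vertices that prefer `M` to `N`. -/
noncomputable def phi [Fintype A] [Fintype B] (I : CritInstance A B)
    (M N : Finset (A × B)) : ℕ :=
  (Finset.univ.filter fun m : A => ManPrefers I M N m).card +
    (Finset.univ.filter fun w : B => WomanPrefers I M N w).card

/-- `M` is a popular feasible matching. -/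
def IsPFM [Fintype A] [Fintype B] (I : CritInstance A B) (M : Finset (A × B)) : Prop :=
  IsFeasible I M ∧ ∀ N, IsFeasible I N → phi I N M ≤ phi I M N

/-- `M` is a minimum size popular feasible matching. -/
def IsMinPFM [Fintype A] [Fintype B] (I : CritInstance A B) (M : Finset (A × B)) : Prop :=
  IsPFM I M ∧ ∀ N, IsPFM I N → M.card ≤ N.card

/-- `M` is a dominant feasible matching. -/
def IsDFM [Fintype A] [Fintype B] (I : CritInstance A B) (M : Finset (A × B)) : Prop :=
  IsPFM I M ∧ ∀ N, IsFeasible I N → M.card < N.card → phi I N M < phi I M N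

/-- `(m,w)` is a `(+1,+1)` edge with respect to `M`: an edge of `E ∖ M` such that `m` is
unmatched or prefers `w` to his partner, and `w` is unmatched or prefers `m` to her partner. -/
def PlusPlus (I : CritInstance A B) (M : Finset (A × B)) (m : A) (w : B) : Prop :=
  (m, w) ∈ I.E ∧ (m, w) ∉ M ∧
    (¬ ManMatched M m ∨ ∃ w', (m, w') ∈ M ∧ I.prefA m w w') ∧
    (¬ WomanMatched M w ∨ ∃ m', (m', w) ∈ M ∧ I.prefB w m m')

/-- `(m,w)` is a `(−1,−1)` edge with respect to `M`: an edge of `E ∖ M` such that `m` is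
matched and prefers his partner to `w`, and `w` is matched and prefers her partner to `m`. -/
def MinusMinus (I : CritInstance A B) (M : Finset (A × B)) (m : A) (w : B) : Prop :=
  (m, w) ∈ I.E ∧ (m, w) ∉ M ∧
    (∃ w', (m, w') ∈ M ∧ I.prefA m w' w) ∧
    (∃ m', (m', w) ∈ M ∧ I.prefB w m' m)

/-- `M` is a stable matching: a matching with no blocking pair. -/
def IsStable (I : CritInstance A B) (M : Finset (A × B)) : Prop :=
  IsMatching I M ∧ ∀ m w, ¬ PlusPlus I M m w

/-- The min-size conditions for a level assignment `(lA, lB)` with respect to `M`: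
(i) matched partners share a level, unmatched vertices have level 0, non-critical men
have level 0; (ii) every `(+1,+1)` edge goes from a man to a strictly higher level woman;
(iii) every edge from a man at level `i` to a woman at level `i − 1` is a `(−1,−1)` edge;
(iv) no edge goes from a man at level `i` to a woman at level `≤ i − 2`. -/
def MinSizeConds (I : CritInstance A B) (M : Finset (A × B))
    (lA : A → ℕ) (lB : B → ℕ) : Prop :=
  (∀ m w, (m, w) ∈ M → lA m = lB w) ∧
  (∀ m, ¬ ManMatched M m → lA m = 0) ∧
  (∀ w, ¬ WomanMatched M w → lB w = 0) ∧
  (∀ m, m ∉ I.C → lA m = 0) ∧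
  (∀ m w, PlusPlus I M m w → lA m < lB w) ∧
  (∀ m w, (m, w) ∈ I.E → lB w + 1 = lA m → MinusMinus I M m w) ∧
  (∀ m w, (m, w) ∈ I.E → ¬ (lB w + 2 ≤ lA m))

/-- The dominant conditions for a level assignment `(lA, lB)` with respect to `M`:
(i) matched partners share a level, unmatched women have level 0, unmatched men have
level 1, non-critical men have level at most 1; (ii)–(iv) as in the min-size conditions. -/
def DomConds (I : CritInstance A B) (M : Finset (A × B))
    (lA : A → ℕ) (lB : B → ℕ) : Prop :=
  (∀ m w, (m, w) ∈ M → lA m = lB w) ∧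
  (∀ m, ¬ ManMatched M m → lA m = 1) ∧
  (∀ w, ¬ WomanMatched M w → lB w = 0) ∧
  (∀ m, m ∉ I.C → lA m ≤ 1) ∧
  (∀ m w, PlusPlus I M m w → lA m < lB w) ∧
  (∀ m w, (m, w) ∈ I.E → lB w + 1 = lA m → MinusMinus I M m w) ∧
  (∀ m w, (m, w) ∈ I.E → ¬ (lB w + 2 ≤ lA m))

/-- Adjacency in the bipartite graph, on the vertex set `A ⊕ B`. -/
def Adj (I : CritInstance A B) : A ⊕ B → A ⊕ B → Prop
  | Sum.inl m, Sum.inr w => (m, w) ∈ I.E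
  | Sum.inr w, Sum.inl m => (m, w) ∈ I.E
  | _, _ => False

/-- The (directed) pair `(u, v)` of vertices spans an edge of the matching `M`. -/
def StepM (M : Finset (A × B)) : A ⊕ B → A ⊕ B → Prop
  | Sum.inl m, Sum.inr w => (m, w) ∈ M
  | Sum.inr w, Sum.inl m => (m, w) ∈ M
  | _, _ => False

/-- The pair `(u, v)` of vertices spans a `(+1,+1)` edge with respect to `M`. -/
def StepPP (I : CritInstance A B) (M : Finset (A × B)) : A ⊕ B → A ⊕ B → Prop
  | Sum.inl m, Sum.inr w => PlusPlus I M m w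
  | Sum.inr w, Sum.inl m => PlusPlus I M m w
  | _, _ => False

/-- The pair `(u, v)` of vertices spans a `(−1,−1)` edge with respect to `M`. -/
def StepMM (I : CritInstance A B) (M : Finset (A × B)) : A ⊕ B → A ⊕ B → Prop
  | Sum.inl m, Sum.inr w => MinusMinus I M m w
  | Sum.inr w, Sum.inl m => MinusMinus I M m w
  | _, _ => False

/-- A vertex of `A ⊕ B` is matched in `M`. -/
def VMatched (M : Finset (A × B)) : A ⊕ B → Prop
  | Sum.inl m => ManMatched M m
  | Sum.inr w => WomanMatched M w

/-- An `M`-alternating path in the graph: a sequence of distinct vertices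
`vert 0, …, vert len` (`len ≥ 1` edges), consecutive vertices adjacent, with
consecutive edges alternately inside and outside `M`. -/
structure AltPath (I : CritInstance A B) (M : Finset (A × B)) where
  len : ℕ
  len_pos : 0 < len
  vert : ℕ → A ⊕ B
  inj : ∀ i j, i ≤ len → j ≤ len → vert i = vert j → i = j
  adj : ∀ i, i < len → Adj I (vert i) (vert (i + 1))
  alternate : ∀ i, i + 1 < len →
    (StepM M (vert i) (vert (i + 1)) ↔ ¬ StepM M (vert (i + 1)) (vert (i + 2)))

namespace AltPath

variable {I : CritInstance A B} {M : Finset (A × B)}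

/-- The number of `(+1,+1)` edges of the path. -/
noncomputable def countPP (ρ : AltPath I M) : ℕ :=
  ((Finset.range ρ.len).filter fun i => StepPP I M (ρ.vert i) (ρ.vert (i + 1))).card

/-- The number of `(−1,−1)` edges of the path. -/
noncomputable def countMM (ρ : AltPath I M) : ℕ :=
  ((Finset.range ρ.len).filter fun i => StepMM I M (ρ.vert i) (ρ.vert (i + 1))).card

/-- The vertex `u` lies on the path. -/
def Mem (ρ : AltPath I M) (u : A ⊕ B) : Prop := ∃ i ≤ ρ.len, ρ.vert i = u

/-- The set of edges of the path, as a set of pairs in `A × B`. -/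
noncomputable def edges (ρ : AltPath I M) : Finset (A × B) :=
  I.E.filter fun e => ∃ i < ρ.len,
    (ρ.vert i = Sum.inl e.1 ∧ ρ.vert (i + 1) = Sum.inr e.2) ∨
    (ρ.vert i = Sum.inr e.2 ∧ ρ.vert (i + 1) = Sum.inl e.1)

end AltPath

/-- An `M`-alternating cycle: a closed sequence of vertices `vert 0, …, vert len = vert 0`
(distinct except for the return), consecutive vertices adjacent, with edges alternately
inside and outside `M`, including around the wrap. -/
structure AltCycle (I : CritInstance A B) (M : Finset (A × B)) where
  len : ℕ
  len_pos : 0 < len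
  vert : ℕ → A ⊕ B
  closed : vert len = vert 0
  inj : ∀ i j, i < len → j < len → vert i = vert j → i = j
  adj : ∀ i, i < len → Adj I (vert i) (vert (i + 1))
  alternate : ∀ i, i + 1 < len →
    (StepM M (vert i) (vert (i + 1)) ↔ ¬ StepM M (vert (i + 1)) (vert (i + 2)))
  alternate_wrap : StepM M (vert (len - 1)) (vert len) ↔ ¬ StepM M (vert 0) (vert 1)

namespace AltCycle

variable {I : CritInstance A B} {M : Finset (A × B)}

/-- The number of `(+1,+1)` edges of the cycle. -/
noncomputable def countPP (σ : AltCycle I M) : ℕ :=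
  ((Finset.range σ.len).filter fun i => StepPP I M (σ.vert i) (σ.vert (i + 1))).card

/-- The number of `(−1,−1)` edges of the cycle. -/
noncomputable def countMM (σ : AltCycle I M) : ℕ :=
  ((Finset.range σ.len).filter fun i => StepMM I M (σ.vert i) (σ.vert (i + 1))).card

end AltCycle

/-- A size-increasing alternating path (SIAP) for `M`: an `M`-alternating path whose two
endpoints are a man unmatched in `M` and a woman unmatched in `M`, and which has equally
many `(+1,+1)` and `(−1,−1)` edges. -/
def IsSIAP (I : CritInstance A B) (M : Finset (A × B)) (ρ : AltPath I M) : Prop :=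
  (((∃ m, ρ.vert 0 = Sum.inl m ∧ ¬ ManMatched M m) ∧
      (∃ w, ρ.vert ρ.len = Sum.inr w ∧ ¬ WomanMatched M w)) ∨
    ((∃ w, ρ.vert 0 = Sum.inr w ∧ ¬ WomanMatched M w) ∧
      (∃ m, ρ.vert ρ.len = Sum.inl m ∧ ¬ ManMatched M m))) ∧
  ρ.countPP = ρ.countMM

/-- A size-reducing alternating path (SRAP) for `M` with respect to the level assignment
`(lA, lB)`: an `M`-alternating path both of whose terminal edges lie in `M`, starting at a
woman matched in `M` at level 0, ending at a non-critical man at level 1, whose number of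
`(+1,+1)` edges is exactly one more than its number of `(−1,−1)` edges. -/
def IsSRAP (I : CritInstance A B) (M : Finset (A × B)) (lA : A → ℕ) (lB : B → ℕ)
    (ρ : AltPath I M) : Prop :=
  StepM M (ρ.vert 0) (ρ.vert 1) ∧
  StepM M (ρ.vert (ρ.len - 1)) (ρ.vert ρ.len) ∧
  (((∃ w, ρ.vert 0 = Sum.inr w ∧ WomanMatched M w ∧ lB w = 0) ∧
      (∃ m, ρ.vert ρ.len = Sum.inl m ∧ m ∉ I.C ∧ lA m = 1)) ∨
    ((∃ m, ρ.vert 0 = Sum.inl m ∧ m ∉ I.C ∧ lA m = 1) ∧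
      (∃ w, ρ.vert ρ.len = Sum.inr w ∧ WomanMatched M w ∧ lB w = 0))) ∧
  ρ.countPP = ρ.countMM + 1

end CritInstance

open Finset in
/-- A finite system of difference constraints `p u + k ≤ p v`, one for each arc `(u, v, k)`, is
solvable over the integers as soon as no permutation along arcs has positive total weight. -/
theorem exists_potential {V : Type*} [Fintype V] (K : Finset (V × V × ℤ))
    (hloop : ∀ v, (v, v, 0) ∈ K)
    (hK : ∀ (σ : Equiv.Perm V) (k : V → ℤ), (∀ v, (v, σ v, k v) ∈ K) → ∑ v, k v ≤ 0) :
    ∃ p : V → ℤ, ∀ u v k, (u, v, k) ∈ K → p u + k ≤ p v := by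
  let violation : (V → ℤ) → ℕ := fun p => ∑ e ∈ K, (p e.1 + e.2.2 - p e.2.1).toNat
  obtain ⟨p, hp⟩ : ∃ p, ∀ q, violation p ≤ violation q :=
    ⟨Function.argmin violation, fun q => Function.argmin_le violation q⟩
  refine ⟨p, ?_⟩
  by_contra! hcon
  obtain ⟨a, b, k₀, hab, hlt⟩ := hcon
  let T : V → V → Prop := fun u v => ∃ k, (u, v, k) ∈ K ∧ p v ≤ p u + k
  have hT : ∀ u, T u u := fun u => ⟨0, hloop u, by simp⟩
  let good : Set (Finset V) := {S | a ∈ S ∧ ∀ c ∈ S, ∃ σ : Equiv.Perm V,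
    σ a = c ∧ (∀ u, u ≠ a → T u (σ u)) ∧ ∀ u, u ∉ S → σ u = u}
  have hgood : {a} ∈ good := by
    refine ⟨by simp, fun c hc => ⟨1, ?_, fun u _ => hT u, fun u _ => rfl⟩⟩
    simp_all
  obtain ⟨S, hS, hmax⟩ := (Set.toFinite good).exists_maximal ⟨_, hgood⟩
  have hclosed : ∀ u c, c ∈ S → T u c → u ∈ S := by
    intro u c hc huc
    by_contra hu
    have hau : a ≠ u := fun h => hu (h ▸ hS.1)
    have hins : insert u S ∈ good := by
      refine ⟨mem_insert_of_mem hS.1, fun d hd => ?_⟩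
      rcases mem_insert.1 hd with rfl | hd
      · obtain ⟨σ, h₁, h₂, h₃⟩ := hS.2 c hc
        refine ⟨σ * Equiv.swap a d, by simp [h₃ d hu], fun x hx => ?_, fun x hx => ?_⟩
        · by_cases hxd : x = d
          · subst hxd
            simpa [h₁] using huc
          · simpa [Equiv.swap_apply_of_ne_of_ne hx hxd] using h₂ x hx
        · have hxS : x ∉ S := fun h => hx (mem_insert_of_mem h)
          have hxd : x ≠ d := fun h => hx (h ▸ mem_insert_self _ _)
          have hxa : x ≠ a := fun h => hxS (h ▸ hS.1)
          simpa [Equiv.swap_apply_of_ne_of_ne hxa hxd] using h₃ x hxS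
      · obtain ⟨σ, h₁, h₂, h₃⟩ := hS.2 d hd
        exact ⟨σ, h₁, h₂, fun x hx => h₃ x fun h => hx (mem_insert_of_mem h)⟩
    exact hu (hmax hins (subset_insert _ _) (mem_insert_self _ _))
  by_cases hb : b ∈ S
  · obtain ⟨σ, h₁, h₂, -⟩ := hS.2 b hb
    have hex : ∀ u, ∃ k, (u, σ u, k) ∈ K ∧ p (σ u) ≤ p u + k ∧ (u = a → p (σ u) < p u + k) := by
      intro u
      by_cases hu : u = a
      · subst hu
        exact ⟨k₀, h₁ ▸ hab, by rw [h₁]; exact hlt.le, fun _ => by rw [h₁]; exact hlt⟩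
      · obtain ⟨k, hk, hk'⟩ := h₂ u hu
        exact ⟨k, hk, hk', fun h => absurd h hu⟩
    choose k hk hle hlt' using hex
    have hsum : ∑ u, p (σ u) < ∑ u, (p u + k u) :=
      sum_lt_sum (fun u _ => hle u) ⟨a, mem_univ _, hlt' a rfl⟩
    rw [Equiv.sum_comp σ p, sum_add_distrib] at hsum
    have := hK σ k hk
    omega
  · refine absurd (hp fun v => if v ∈ S then p v else p v + 1) (not_le.2 ?_)
    refine sum_lt_sum ?_ ⟨(a, b, k₀), hab, ?_⟩
    · rintro ⟨u, v, k⟩ he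
      by_cases hu : u ∈ S <;> by_cases hv : v ∈ S <;> simp only [hu, hv, if_true, if_false]
      · exact le_rfl
      · omega
      · have : ¬ p v ≤ p u + k := fun h => hu (hclosed u v hv ⟨k, he, h⟩)
        omega
      · omega
    · simp only [hS.1, hb, if_true, if_false]
      omega

namespace CritInstance

variable {A : Type u} {B : Type v}

/-- The margin by which man `m` votes for `N` against `M`. -/
noncomputable def manVote (I : CritInstance A B) (M N : Finset (A × B)) (m : A) : ℤ :=
  (if ManPrefers I N M m then 1 else 0) - (if ManPrefers I M N m then 1 else 0)

/-- The margin by which woman `w` votes for `N` against `M`. -/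
noncomputable def womanVote (I : CritInstance A B) (M N : Finset (A × B)) (w : B) : ℤ :=
  (if WomanPrefers I N M w then 1 else 0) - (if WomanPrefers I M N w then 1 else 0)

/-- Half the sum of the labels of an edge that is not in `M`, and `0` for an edge of `M`. -/
noncomputable def edgeWeight (I : CritInstance A B) (M : Finset (A × B)) (m : A) (w : B) : ℤ :=
  if PlusPlus I M m w then 1 else if MinusMinus I M m w then -1 else 0

section Votes

variable {I : CritInstance A B} {M N : Finset (A × B)}

theorem phi_sub_phi [Fintype A] [Fintype B] :
    (phi I N M : ℤ) - phi I M N = ∑ m, manVote I M N m + ∑ w, womanVote I M N w := by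
  simp only [phi, manVote, womanVote, Finset.card_filter, Finset.sum_sub_distrib]
  push_cast
  ring

theorem neg_one_le_manVote (m : A) : -1 ≤ manVote I M N m := by
  unfold manVote; split_ifs <;> omega

theorem neg_one_le_womanVote (w : B) : -1 ≤ womanVote I M N w := by
  unfold womanVote; split_ifs <;> omega

theorem manVote_nonneg {m : A} (h : ¬ ManPrefers I M N m) : 0 ≤ manVote I M N m := by
  unfold manVote; rw [if_neg h]; split_ifs <;> omega

theorem womanVote_nonneg {w : B} (h : ¬ WomanPrefers I M N w) : 0 ≤ womanVote I M N w := by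
  unfold womanVote; rw [if_neg h]; split_ifs <;> omega

theorem not_manPrefers_of_mem (hM : IsMatching I M) (hN : IsMatching I N) {m : A} {w : B}
    (hw : (m, w) ∈ N)
    (h : ¬ ManMatched M m ∨ ∃ w', (m, w') ∈ M ∧ (w = w' ∨ I.prefA m w w')) :
    ¬ ManPrefers I M N m := by
  rintro ⟨x, hx, hx' | ⟨y, hy, hxy⟩⟩
  · exact hx' ⟨w, hw⟩
  · obtain rfl := hN.2.1 hw hy
    rcases h with h | ⟨w', hw', h⟩
    · exact h ⟨x, hx⟩
    · obtain rfl := hM.2.1 hx hw'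
      rcases h with rfl | h
      · exact I.prefA_irrefl _ _ hxy
      · exact I.prefA_irrefl _ _ (I.prefA_trans _ _ _ _ hxy h)

theorem not_womanPrefers_of_mem (hM : IsMatching I M) (hN : IsMatching I N) {m : A} {w : B}
    (hw : (m, w) ∈ N)
    (h : ¬ WomanMatched M w ∨ ∃ m', (m', w) ∈ M ∧ (m = m' ∨ I.prefB w m m')) :
    ¬ WomanPrefers I M N w := by
  rintro ⟨x, hx, hx' | ⟨y, hy, hxy⟩⟩
  · exact hx' ⟨m, hw⟩
  · obtain rfl := hN.2.2 hw hy
    rcases h with h | ⟨m', hm', h⟩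
    · exact h ⟨x, hx⟩
    · obtain rfl := hM.2.2 hx hm'
      rcases h with rfl | h
      · exact I.prefB_irrefl _ _ hxy
      · exact I.prefB_irrefl _ _ (I.prefB_trans _ _ _ _ hxy h)

theorem manVote_eq_one (hM : IsMatching I M) (hN : IsMatching I N) {m : A} {w : B}
    (hw : (m, w) ∈ N) (h : ¬ ManMatched M m ∨ ∃ w', (m, w') ∈ M ∧ I.prefA m w w') :
    manVote I M N m = 1 := by
  have h₁ : ManPrefers I N M m := ⟨w, hw, h⟩
  have h₂ : ¬ ManPrefers I M N m := not_manPrefers_of_mem hM hN hw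
    (h.imp_right fun ⟨w', h, h'⟩ => ⟨w', h, Or.inr h'⟩)
  simp [manVote, h₁, h₂]

theorem womanVote_eq_one (hM : IsMatching I M) (hN : IsMatching I N) {m : A} {w : B}
    (hw : (m, w) ∈ N) (h : ¬ WomanMatched M w ∨ ∃ m', (m', w) ∈ M ∧ I.prefB w m m') :
    womanVote I M N w = 1 := by
  have h₁ : WomanPrefers I N M w := ⟨m, hw, h⟩
  have h₂ : ¬ WomanPrefers I M N w := not_womanPrefers_of_mem hM hN hw
    (h.imp_right fun ⟨w', h, h'⟩ => ⟨w', h, Or.inr h'⟩)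
  simp [womanVote, h₁, h₂]

theorem two_mul_edgeWeight_le (hM : IsMatching I M) (hN : IsMatching I N) {m : A} {w : B}
    (hw : (m, w) ∈ N) :
    2 * edgeWeight I M m w ≤ manVote I M N m + womanVote I M N w := by
  by_cases hmw : (m, w) ∈ M
  · have h₁ : ¬ PlusPlus I M m w := fun h => h.2.1 hmw
    have h₂ : ¬ MinusMinus I M m w := fun h => h.2.1 hmw
    have h₃ := manVote_nonneg (not_manPrefers_of_mem hM hN hw (Or.inr ⟨w, hmw, Or.inl rfl⟩))
    have h₄ := womanVote_nonneg (not_womanPrefers_of_mem hM hN hw (Or.inr ⟨m, hmw, Or.inl rfl⟩))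
    simp only [edgeWeight, h₁, h₂, if_false]
    omega
  · have h_man : (¬ ManMatched M m ∨ ∃ w', (m, w') ∈ M ∧ I.prefA m w w') ∨
        ∃ w', (m, w') ∈ M ∧ I.prefA m w' w := by
      by_cases h : ManMatched M m
      · obtain ⟨w', hw'⟩ := h
        have hne : w ≠ w' := fun h => hmw (h ▸ hw')
        rcases I.prefA_total m w w' (hN.1 hw) (hM.1 hw') hne with h | h
        · exact Or.inl (Or.inr ⟨w', hw', h⟩)
        · exact Or.inr ⟨w', hw', h⟩
      · exact Or.inl (Or.inl h)
    have h_woman : (¬ WomanMatched M w ∨ ∃ m', (m', w) ∈ M ∧ I.prefB w m m') ∨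
        ∃ m', (m', w) ∈ M ∧ I.prefB w m' m := by
      by_cases h : WomanMatched M w
      · obtain ⟨m', hm'⟩ := h
        have hne : m ≠ m' := fun h => hmw (h ▸ hm')
        rcases I.prefB_total w m m' (hN.1 hw) (hM.1 hm') hne with h | h
        · exact Or.inl (Or.inr ⟨m', hm', h⟩)
        · exact Or.inr ⟨m', hm', h⟩
      · exact Or.inl (Or.inl h)
    have hm := neg_one_le_manVote (I := I) (M := M) (N := N) m
    have hv := neg_one_le_womanVote (I := I) (M := M) (N := N) w
    by_cases h_pp : PlusPlus I M m w
    · have h₁ := manVote_eq_one hM hN hw h_pp.2.2.1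
      have h₂ := womanVote_eq_one hM hN hw h_pp.2.2.2
      simp only [edgeWeight, h_pp, if_true]
      omega
    · by_cases h_mm : MinusMinus I M m w
      · simp only [edgeWeight, h_pp, h_mm, if_true, if_false]
        omega
      · simp only [edgeWeight, h_pp, h_mm, if_false]
        rcases h_man with h₁ | h₁
        · have := manVote_eq_one hM hN hw h₁
          omega
        · rcases h_woman with h₂ | h₂
          · have := womanVote_eq_one hM hN hw h₂
            omega
          · exact absurd ⟨hN.1 hw, hmw, h₁, h₂⟩ h_mm

end Votes

/-- The vertex of the constraint graph standing for woman `w`: that of her partner if she is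
matched in `M`, and her own otherwise. -/
noncomputable def node (M : Finset (A × B)) (w : B) : Option (A ⊕ B) :=
  if h : WomanMatched M w then some (Sum.inl h.choose) else some (Sum.inr w)

/-- The difference constraints on levels: `Arc I M u v k` requires the level of `v` to be at
least `k` more than that of `u`. The vertex `none` marks level `0`. -/
inductive Arc (I : CritInstance A B) (M : Finset (A × B)) :
    Option (A ⊕ B) → Option (A ⊕ B) → ℤ → Prop
  | loop (v : Option (A ⊕ B)) : Arc I M v v 0
  | edge (m : A) (w : B) (h : (m, w) ∈ I.E) :
      Arc I M (some (Sum.inl m)) (node M w) (edgeWeight I M m w)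
  | nonCritical (m : A) (h : ManMatched M m) (hC : m ∉ I.C) :
      Arc I M (some (Sum.inl m)) none (-1)
  | unmatchedWoman (w : B) (h : ¬ WomanMatched M w) : Arc I M (some (Sum.inr w)) none 0
  | matchedMan (m : A) (h : ManMatched M m) : Arc I M none (some (Sum.inl m)) 0
  | unmatchedMan (m : A) (h : ¬ ManMatched M m) : Arc I M none (some (Sum.inl m)) 1

section ConstraintGraph

variable {I : CritInstance A B} {M : Finset (A × B)}

theorem node_of_mem (hM : IsMatching I M) {m : A} {w : B} (h : (m, w) ∈ M) :
    node M w = some (Sum.inl m) := by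
  have hw : WomanMatched M w := ⟨m, h⟩
  rw [node, dif_pos hw, hM.2.2 hw.choose_spec h]

theorem node_of_unmatched {w : B} (h : ¬ WomanMatched M w) : node M w = some (Sum.inr w) := by
  rw [node, dif_neg h]

theorem node_eq_inl {m : A} {w : B} (h : node M w = some (Sum.inl m)) : (m, w) ∈ M := by
  unfold node at h
  split_ifs at h with hw
  · simp only [Option.some.injEq, Sum.inl.injEq] at h
    exact h ▸ hw.choose_spec
  · simp at h

theorem node_eq_inr {w w' : B} (h : node M w = some (Sum.inr w')) :
    w = w' ∧ ¬ WomanMatched M w := by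
  unfold node at h
  split_ifs at h with hw
  · simp at h
  · simp only [Option.some.injEq, Sum.inr.injEq] at h
    exact ⟨h, hw⟩

theorem node_ne_none (w : B) : node M w ≠ none := by
  unfold node
  split_ifs <;> simp

theorem node_injective (hM : IsMatching I M) : Function.Injective (node M) := by
  intro w w' h
  by_cases hw : WomanMatched M w
  · obtain ⟨m, hm⟩ := hw
    rw [node_of_mem hM hm] at h
    exact hM.2.1 hm (node_eq_inl h.symm)
  · rw [node_of_unmatched hw] at h
    exact (node_eq_inr h.symm).1.symm

theorem edgeWeight_of_mem {m : A} {w : B} (h : (m, w) ∈ M) : edgeWeight I M m w = 0 := by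
  have h₁ : ¬ PlusPlus I M m w := fun h' => h'.2.1 h
  have h₂ : ¬ MinusMinus I M m w := fun h' => h'.2.1 h
  simp [edgeWeight, h₁, h₂]

theorem Arc.bounded {u v : Option (A ⊕ B)} {k : ℤ} (h : Arc I M u v k) : -1 ≤ k ∧ k ≤ 1 := by
  cases h with
  | edge m w h => unfold edgeWeight; split_ifs <;> omega
  | _ => omega

theorem Arc.of_inl {m : A} {v : Option (A ⊕ B)} {k : ℤ} (hM : IsMatching I M)
    (h : Arc I M (some (Sum.inl m)) v k) :
    (∃ w, (m, w) ∈ I.E ∧ v = node M w) ∨ (v = none ∧ m ∉ I.C) ∨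
      (v = some (Sum.inl m) ∧ ¬ ManMatched M m) := by
  cases h with
  | loop =>
    by_cases hm : ManMatched M m
    · obtain ⟨w, hw⟩ := hm
      exact Or.inl ⟨w, hM.1 hw, (node_of_mem hM hw).symm⟩
    · exact Or.inr (Or.inr ⟨rfl, hm⟩)
  | edge _ w h => exact Or.inl ⟨w, h, rfl⟩
  | nonCritical _ h hC => exact Or.inr (Or.inl ⟨rfl, hC⟩)

theorem IsMatching.card_image_fst {N : Finset (A × B)} (hN : IsMatching I N) :
    (N.image Prod.fst).card = N.card := by
  refine Finset.card_image_of_injOn ?_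
  rintro ⟨m, w⟩ h ⟨m', w'⟩ h' (rfl : m = m')
  rw [hN.2.1 h h']

/-- The matching obtained from a permutation of the constraint graph along its arcs. -/
noncomputable def permMatching [Fintype A] [Fintype B] (M : Finset (A × B))
    (σ : Equiv.Perm (Option (A ⊕ B))) : Finset (A × B) :=
  Finset.univ.filter fun e => σ (some (Sum.inl e.1)) = node M e.2

variable [Fintype A] [Fintype B] {σ : Equiv.Perm (Option (A ⊕ B))}

theorem mem_permMatching {m : A} {w : B} :
    (m, w) ∈ permMatching M σ ↔ σ (some (Sum.inl m)) = node M w := by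
  simp [permMatching]

theorem isFeasible_permMatching (hM : IsFeasible I M) {k : Option (A ⊕ B) → ℤ}
    (hσ : ∀ v, Arc I M v (σ v) (k v)) : IsFeasible I (permMatching M σ) := by
  refine ⟨⟨?_, ?_, ?_⟩, ?_⟩
  · rintro ⟨m, w⟩ h
    rw [mem_permMatching] at h
    rcases (hσ (some (Sum.inl m))).of_inl hM.1 with ⟨w', hw', h'⟩ | ⟨h', -⟩ | ⟨h', hm⟩
    · rwa [node_injective hM.1 (h.symm.trans h')]
    · exact absurd (h.symm.trans h') (node_ne_none w)
    · exact absurd ⟨w, node_eq_inl (h.symm.trans h')⟩ hm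
  · intro m w w' h h'
    rw [mem_permMatching] at h h'
    exact node_injective hM.1 (h.symm.trans h')
  · intro m m' w h h'
    rw [mem_permMatching] at h h'
    simpa using σ.injective (h.trans h'.symm)
  · intro m hm
    rcases (hσ (some (Sum.inl m))).of_inl hM.1 with ⟨w, -, h⟩ | ⟨-, h⟩ | ⟨-, h⟩
    · exact ⟨w, mem_permMatching.2 h⟩
    · exact absurd hm h
    · exact absurd (hM.2 m hm) h

theorem card_lt_card_permMatching (hM : IsFeasible I M) {k : Option (A ⊕ B) → ℤ}
    (hσ : ∀ v, Arc I M v (σ v) (k v)) {m₀ : A} (hm₀ : ¬ ManMatched M m₀)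
    (h_start : σ none = some (Sum.inl m₀)) {w₀ : B} (h_end : σ (some (Sum.inr w₀)) = none) :
    M.card < (permMatching M σ).card := by
  have h_matched : ∀ m, ManMatched M m ∨ m = m₀ → ManMatched (permMatching M σ) m := by
    intro m hm
    rcases (hσ (some (Sum.inl m))).of_inl hM.1 with ⟨w, -, h⟩ | ⟨h, -⟩ | ⟨h, h'⟩
    · exact ⟨w, mem_permMatching.2 h⟩
    · simpa using σ.injective (h.trans h_end.symm)
    · rcases hm with hm | rfl
      · exact absurd hm h'
      · simpa using σ.injective (h.trans h_start.symm)
  have h_iff : ∀ (N : Finset (A × B)) m, m ∈ N.image Prod.fst ↔ ManMatched N m := by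
    intro N m
    simp [ManMatched]
  rw [← hM.1.card_image_fst, ← (isFeasible_permMatching hM hσ).1.card_image_fst]
  refine Finset.card_lt_card (Finset.ssubset_iff_of_subset ?_ |>.2 ⟨m₀, ?_, ?_⟩)
  · intro m hm
    exact (h_iff _ _).2 (h_matched m (Or.inl ((h_iff _ _).1 hm)))
  · exact (h_iff _ _).2 (h_matched m₀ (Or.inr rfl))
  · exact fun h => hm₀ ((h_iff _ _).1 h)

/-- Correction for the arc leaving `none`. -/
noncomputable def startCorrection (M : Finset (A × B)) : Option (A ⊕ B) → ℤ
  | some (Sum.inl m) => if ManMatched M m then 1 else 2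
  | _ => 0

/-- Correction for the arc entering `none`. -/
def endCorrection : Option (A ⊕ B) → ℤ
  | some (Sum.inl _) => -1
  | _ => 0

theorem two_mul_sum_le (hM : IsFeasible I M) {k : Option (A ⊕ B) → ℤ}
    (hσ : ∀ v, Arc I M v (σ v) (k v)) :
    2 * ∑ v, k v ≤ (phi I (permMatching M σ) M : ℤ) - phi I M (permMatching M σ) +
      startCorrection M (σ none) + endCorrection (σ.symm none) := by
  have hN := (isFeasible_permMatching hM hσ).1
  set N := permMatching M σ with hNdef
  let f : Option (A ⊕ B) → ℤ := fun v =>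
    match v with
    | some (Sum.inl m) => manVote I M N m
    | _ => 0
  let g : Option (A ⊕ B) → ℤ := fun v => ∑ w with node M w = v, womanVote I M N w
  have hf : ∑ v, f v = ∑ m, manVote I M N m := by
    simp [f, Fintype.sum_option]
  have hg : ∑ v, g (σ v) = ∑ w, womanVote I M N w := by
    rw [Equiv.sum_comp σ g]
    exact Finset.sum_fiberwise _ _ _
  have hg_node : ∀ w, g (node M w) = womanVote I M N w := by
    intro w
    have : (Finset.univ.filter fun w' => node M w' = node M w) = {w} := by
      ext w'
      simp [(node_injective hM.1).eq_iff]
    simp only [g, this, Finset.sum_singleton]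
  have hg_zero : ∀ v, (∀ w, node M w ≠ v) → g v = 0 := by
    intro v hv
    simp only [g]
    rw [Finset.filter_false_of_mem fun w _ => hv w, Finset.sum_empty]
  have key : ∀ u v k, Arc I M u v k → σ u = v → 2 * k ≤ f u + g v +
      (if u = none then startCorrection M v else 0) + (if v = none then endCorrection u else 0) := by
    intro u v k h huv
    have h_edge : ∀ m w, u = some (Sum.inl m) → v = node M w →
        2 * edgeWeight I M m w ≤ manVote I M N m + womanVote I M N w := by
      rintro m w rfl rfl
      exact two_mul_edgeWeight_le hM.1 hN (mem_permMatching.2 huv)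
    cases h with
    | loop =>
      rcases u with _ | m | w
      · simp [f, hg_zero none node_ne_none, startCorrection, endCorrection]
      · by_cases hm : ManMatched M m
        · obtain ⟨w, hw⟩ := hm
          have h := h_edge m w rfl (node_of_mem hM.1 hw).symm
          rw [edgeWeight_of_mem hw] at h
          rw [← node_of_mem hM.1 hw, hg_node, node_of_mem hM.1 hw]
          simpa [f] using h
        · have h₁ : g (some (Sum.inl m)) = 0 :=
            hg_zero _ fun w hw => hm ⟨w, node_eq_inl hw⟩
          have h₂ : 0 ≤ manVote I M N m :=
            manVote_nonneg fun ⟨w, hw, _⟩ => hm ⟨w, hw⟩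
          simpa [f, h₁] using h₂
      · by_cases hw : WomanMatched M w
        · have h₁ : g (some (Sum.inr w)) = 0 := hg_zero _ fun w' hw' => by
            obtain ⟨rfl, h⟩ := node_eq_inr hw'
            exact h hw
          simp [f, h₁]
        · have h₂ : 0 ≤ womanVote I M N w :=
            womanVote_nonneg fun ⟨m, hm, _⟩ => hw ⟨m, hm⟩
          have h₁ := hg_node w
          rw [node_of_unmatched hw] at h₁
          simpa [f, h₁] using h₂
    | edge m w h =>
      have h := h_edge m w rfl rfl
      rw [hg_node]
      simpa [f, node_ne_none] using h
    | nonCritical m h hC =>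
      have := neg_one_le_manVote (I := I) (M := M) (N := N) m
      simp [f, hg_zero none node_ne_none, endCorrection]
      omega
    | unmatchedWoman w h =>
      simp [f, hg_zero none node_ne_none, endCorrection]
    | matchedMan m h =>
      obtain ⟨w, hw⟩ := id h
      have := neg_one_le_womanVote (I := I) (M := M) (N := N) w
      rw [← node_of_mem hM.1 hw, hg_node, node_of_mem hM.1 hw]
      simp [f, startCorrection, h]
      omega
    | unmatchedMan m h =>
      have h₁ : g (some (Sum.inl m)) = 0 := hg_zero _ fun w hw => h ⟨w, node_eq_inl hw⟩
      simp [f, h₁, startCorrection, h]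
  have h_start : ∑ v, (if v = none then startCorrection M (σ v) else 0) =
      startCorrection M (σ none) := by
    simp only [Finset.sum_ite_eq', Finset.mem_univ, if_true]
  have h_end : ∑ v, (if σ v = none then endCorrection v else 0) =
      endCorrection (σ.symm none) := by
    simp only [← Equiv.eq_symm_apply, Finset.sum_ite_eq', Finset.mem_univ, if_true]
  rw [phi_sub_phi, ← hf, ← hg, ← h_start, ← h_end, Finset.mul_sum, ← Finset.sum_add_distrib,
    ← Finset.sum_add_distrib, ← Finset.sum_add_distrib]
  exact Finset.sum_le_sum fun v _ => key v (σ v) (k v) (hσ v) rfl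

theorem sum_nonpos_of_isDFM (hM : IsDFM I M) {k : Option (A ⊕ B) → ℤ}
    (hσ : ∀ v, Arc I M v (σ v) (k v)) : ∑ v, k v ≤ 0 := by
  have h := two_mul_sum_le hM.1.1 hσ
  have hN := isFeasible_permMatching hM.1.1 hσ
  have h_pop := hM.1.2 _ hN
  have h_dom := hM.2 _ hN
  have h_symm : σ (σ.symm none) = none := σ.apply_symm_apply none
  rcases h_end : σ.symm none with _ | m | w
  · rw [h_end] at h h_symm
    simp only [h_symm, startCorrection, endCorrection] at h
    omega
  · have : startCorrection M (σ none) ≤ 2 := by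
      unfold startCorrection
      split <;> [split_ifs; skip] <;> omega
    rw [h_end] at h
    simp only [endCorrection] at h
    omega
  · rw [h_end] at h h_symm
    simp only [endCorrection] at h
    rcases h_start : σ none with _ | m | w'
    · rw [h_start] at h
      simp only [startCorrection] at h
      omega
    · by_cases hm : ManMatched M m
      · rw [h_start] at h
        simp only [startCorrection, hm, if_true] at h
        omega
      · have := h_dom (card_lt_card_permMatching hM.1.1 hσ hm h_start h_symm)
        rw [h_start] at h
        simp only [startCorrection, hm, if_false] at h
        omega
    · rw [h_start] at h
      simp only [startCorrection] at h
      omega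

theorem IsDFM.exists_domConds (hM : IsDFM I M) :
    ∃ (lA : A → ℕ) (lB : B → ℕ), DomConds I M lA lB := by
  have hmat := hM.1.1.1
  let K : Finset (Option (A ⊕ B) × Option (A ⊕ B) × ℤ) :=
    (Finset.univ ×ˢ Finset.univ ×ˢ Finset.Icc (-1) 1).filter fun e => Arc I M e.1 e.2.1 e.2.2
  have hK : ∀ u v k, (u, v, k) ∈ K ↔ Arc I M u v k := by
    intro u v k
    simp only [K, Finset.mem_filter, Finset.mem_product, Finset.mem_univ, Finset.mem_Icc,
      true_and, and_iff_right_iff_imp]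
    exact Arc.bounded
  obtain ⟨p, hp⟩ := exists_potential K (fun v => (hK _ _ _).2 (Arc.loop v))
    fun σ k h => sum_nonpos_of_isDFM hM fun v => (hK _ _ _).1 (h v)
  replace hp : ∀ u v k, Arc I M u v k → p u + k ≤ p v := fun u v k h => hp u v k ((hK _ _ _).2 h)
  let q : Option (A ⊕ B) → ℤ := fun v => p v - p none
  have hq_matched : ∀ m, ManMatched M m → 0 ≤ q (some (Sum.inl m)) := fun m h => by
    have := hp _ _ _ (Arc.matchedMan m h)
    simp only [q]; omega
  have hq_unmatched : ∀ m, ¬ ManMatched M m → 1 ≤ q (some (Sum.inl m)) := fun m h => by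
    have := hp _ _ _ (Arc.unmatchedMan m h)
    simp only [q]; omega
  let lA : A → ℕ := fun m => if ManMatched M m then (q (some (Sum.inl m))).toNat else 1
  let lB : B → ℕ := fun w => if WomanMatched M w then (q (node M w)).toNat else 0
  have hlA : ∀ m, (lA m : ℤ) ≤ q (some (Sum.inl m)) := by
    intro m
    by_cases h : ManMatched M m
    · have := hq_matched m h
      simp only [lA, h, if_true]; omega
    · have := hq_unmatched m h
      simp only [lA, h, if_false]; omega
  have hlB : ∀ w, q (node M w) ≤ lB w := by
    intro w
    by_cases h : WomanMatched M w
    · simp only [lB, h, if_true]; omega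
    · have := hp _ _ _ (Arc.unmatchedWoman w h)
      simp only [lB, h, if_false, node_of_unmatched h, q]; omega
  have h_edge : ∀ m w, (m, w) ∈ I.E → lA m + edgeWeight I M m w ≤ lB w := by
    intro m w h
    have h₁ := hp _ _ _ (Arc.edge m w h)
    have h₂ := hlA m
    have h₃ := hlB w
    simp only [q] at h₂ h₃
    omega
  refine ⟨lA, lB, ?_, ?_, ?_, ?_, ?_, ?_, ?_⟩
  · intro m w h
    have h₁ : ManMatched M m := ⟨w, h⟩
    have h₂ : WomanMatched M w := ⟨m, h⟩
    simp only [lA, lB, h₁, h₂, if_true, node_of_mem hmat h]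
  · intro m h
    simp only [lA, h, if_false]
  · intro w h
    simp only [lB, h, if_false]
  · intro m hC
    by_cases h : ManMatched M m
    · have := hp _ _ _ (Arc.nonCritical m h hC)
      simp only [lA, h, if_true, q]; omega
    · simp only [lA, h, if_false, le_refl]
  · intro m w h
    have := h_edge m w h.1
    simp only [edgeWeight, h, if_true] at this
    omega
  · intro m w h h'
    have := h_edge m w h
    by_contra h_mm
    unfold edgeWeight at this
    split_ifs at this
    all_goals omega
  · intro m w h h'
    have := h_edge m w h
    unfold edgeWeight at this
    split_ifs at this <;> omega

end ConstraintGraph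

/-- Levels satisfying the dominant conditions can be compressed until those above `1` are
consecutive, and only critical men occupy them. -/
theorem DomConds.exists_le {I : CritInstance A B} {M : Finset (A × B)} {lA : A → ℕ} {lB : B → ℕ}
    (h : DomConds I M lA lB) :
    ∃ (lA' : A → ℕ) (lB' : B → ℕ), DomConds I M lA' lB' ∧ ∀ m, lA' m ≤ I.C.card + 1 := by
  obtain ⟨h₁, h₂, h₃, h₄, h₅, h₆, h₇⟩ := h
  let F : ℕ → Finset ℕ := fun x => (I.C.image lA).filter fun y => 2 ≤ y ∧ y ≤ x
  let f : ℕ → ℕ := fun x => min x 1 + (F x).card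
  have hF_mono : ∀ x y, x ≤ y → F x ⊆ F y := fun x y hxy z hz => by
    simp only [F, Finset.mem_filter] at hz ⊢
    exact ⟨hz.1, hz.2.1, hz.2.2.trans hxy⟩
  have hF_low : ∀ x, x ≤ 1 → (F x).card = 0 := fun x hx => by
    rw [Finset.card_eq_zero, Finset.filter_eq_empty_iff]
    intro y _
    omega
  have hf_mono : ∀ x y, x ≤ y → f x ≤ f y := fun x y hxy => by
    have := Finset.card_le_card (hF_mono x y hxy)
    simp only [f]; omega
  have hf_low : ∀ x, x ≤ 1 → f x = x := fun x hx => by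
    simp only [f, hF_low x hx]; omega
  have hf_succ : ∀ x, f (x + 1) ≤ f x + 1 := fun x => by
    rcases Nat.eq_zero_or_pos x with rfl | hx
    · rw [hf_low _ (by omega), hf_low _ (by omega)]
    · have : F (x + 1) ⊆ insert (x + 1) (F x) := fun z hz => by
        simp only [F, Finset.mem_filter, Finset.mem_insert] at hz ⊢
        rcases hz.2.2.eq_or_lt with h | h
        · exact Or.inl h
        · exact Or.inr ⟨hz.1, hz.2.1, by omega⟩
      have := (Finset.card_le_card this).trans (Finset.card_insert_le _ _)
      simp only [f]; omega
  have hf_strict : ∀ x m, x < lA m → f x < f (lA m) := fun x m hx => by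
    by_cases hm : lA m ≤ 1
    · rw [hf_low _ hm, hf_low x (by omega)]
      exact hx
    · have hC : m ∈ I.C := by
        by_contra hC
        exact hm (h₄ m hC)
      have : F x ⊂ F (lA m) := by
        refine (Finset.ssubset_iff_of_subset (hF_mono _ _ hx.le)).2 ⟨lA m, ?_, ?_⟩
        · simp only [F, Finset.mem_filter]
          exact ⟨Finset.mem_image_of_mem _ hC, by omega, le_rfl⟩
        · simp only [F, Finset.mem_filter]
          omega
      have := Finset.card_lt_card this
      simp only [f]; omega
  refine ⟨fun m => f (lA m), fun w => f (lB w), ⟨?_, ?_, ?_, ?_, ?_, ?_, ?_⟩, ?_⟩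
  · intro m w hmw
    simp only [h₁ m w hmw]
  · intro m hm
    simp only [h₂ m hm, hf_low 1 le_rfl]
  · intro w hw
    simp only [h₃ w hw, hf_low 0 zero_le_one]
  · intro m hm
    simpa only [hf_low _ (h₄ m hm)] using h₄ m hm
  · intro m w hmw
    have hlt := h₅ m w hmw
    by_cases hw : WomanMatched M w
    · obtain ⟨m', hm'⟩ := hw
      simp only [← h₁ m' w hm'] at hlt ⊢
      exact hf_strict _ m' hlt
    · rw [h₃ w hw] at hlt
      omega
  · intro m w hmw hf
    have h₈ := h₇ m w hmw
    refine h₆ m w hmw ?_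
    by_contra hne
    have := hf_mono (lA m) (lB w) (by omega)
    simp only at hf
    omega
  · intro m w hmw
    have h₈ := h₇ m w hmw
    have := hf_mono (lA m) (lB w + 1) (by omega)
    have := hf_succ (lB w)
    simp only
    omega
  · intro m
    have : (F (lA m)).card ≤ I.C.card := (Finset.card_filter_le _ _).trans Finset.card_image_le
    simp only [f]; omega

end CritInstance

/-- Every dominant feasible matching admits a level assignment satisfying
the dominant conditions, in which every man has level at most `|C| + 1` and every
non-critical man has level at most `1`. -/
theorem isDFM_exists_levels {A : Type u} {B : Type v} [Fintype A] [Fintype B]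
    (I : CritInstance A B) (M : Finset (A × B)) (hM : I.IsDFM M) :
    ∃ (lA : A → ℕ) (lB : B → ℕ), I.DomConds M lA lB ∧
      (∀ m, lA m ≤ I.C.card + 1) ∧ (∀ m, m ∉ I.C → lA m ≤ 1) := by
  obtain ⟨lA, lB, h⟩ := CritInstance.IsDFM.exists_domConds hM
  obtain ⟨lA', lB', h', hle⟩ := h.exists_le
  exact ⟨lA', lB', h', hle, h'.2.2.2.1⟩
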